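/- The half-line [0,∞) with its standard metric is compressible. Moreover, for each proper function ψ the compressing homeomorphism h can be chosen to be nondecreasing and such that x ↦ h(x)/x is nonincreasing on (0,∞). -/

import Mathlib

open Filter Metric NNReal

/-- A function `φ : [0,∞) → [0,∞)` is sublinear if `φ(t)/t → 0` as `t → ∞`. -/
def Sublinear (φ : ℝ≥0 → ℝ≥0) : Prop :=
  Tendsto (fun t : ℝ≥0 => (φ t : ℝ) / (t : ℝ)) atTop (nhds 0)

/-- A function `ψ : [0,∞) → [0,∞)` is proper if it is nondecreasing and `ψ(t) → ∞`. -/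
def ProperFn (ψ : ℝ≥0 → ℝ≥0) : Prop :=
  Monotone ψ ∧ Tendsto ψ atTop atTop

/-- breakpoints -/
noncomputable def brk (ψ : ℝ≥0 → ℝ≥0) (n : ℕ) : ℝ≥0 := 2 ^ n * (1 + ψ ((n : ℝ≥0) ^ 2))

/-- summands -/
noncomputable def trm (ψ : ℝ≥0 → ℝ≥0) (x : ℝ≥0) (n : ℕ) : ℝ≥0 := min 1 (x / brk ψ n)

/-- the compressing map -/
noncomputable def cmpr (ψ : ℝ≥0 → ℝ≥0) (x : ℝ≥0) : ℝ≥0 := ∑' n, trm ψ x n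

lemma brk_pos (ψ : ℝ≥0 → ℝ≥0) (n : ℕ) : 0 < brk ψ n := by unfold brk; positivity

lemma trm_le_geom (ψ : ℝ≥0 → ℝ≥0) (x : ℝ≥0) (n : ℕ) : trm ψ x n ≤ x * (1 / 2) ^ n := by
  refine (min_le_right _ _).trans ?_
  rw [div_le_iff₀ (brk_pos ψ n), brk]
  have : x * (1 / 2) ^ n * (2 ^ n * (1 + ψ ((n : ℝ≥0) ^ 2)))
      = ((1 / 2) ^ n * 2 ^ n) * (x * (1 + ψ ((n : ℝ≥0) ^ 2))) := by ring
  rw [this, ← mul_pow, one_div, inv_mul_cancel₀ two_ne_zero, one_pow, one_mul]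
  exact le_mul_of_one_le_right (zero_le) (le_add_of_nonneg_right (zero_le))

lemma sum_geom : Summable (fun n : ℕ => (1 / 2 : ℝ≥0) ^ n) :=
  NNReal.summable_geometric (by rw [← NNReal.coe_lt_coe]; norm_num)

lemma tsum_geom : ∑' n : ℕ, (1 / 2 : ℝ≥0) ^ n = 2 := by
  have := tsum_geometric_two
  apply NNReal.coe_injective
  push_cast
  exact this

lemma trm_summable (ψ : ℝ≥0 → ℝ≥0) (x : ℝ≥0) : Summable (trm ψ x) :=
  NNReal.summable_of_le (trm_le_geom ψ x) (sum_geom.mul_left x)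

lemma cmpr_le (ψ : ℝ≥0 → ℝ≥0) (x : ℝ≥0) : cmpr ψ x ≤ x * 2 := by
  rw [← tsum_geom, ← NNReal.tsum_mul_left]
  exact (trm_summable ψ x).tsum_le_tsum (trm_le_geom ψ x) (sum_geom.mul_left x)

lemma trm_mono (ψ : ℝ≥0 → ℝ≥0) (n : ℕ) : Monotone (fun x => trm ψ x n) := by
  intro x y hxy
  simp only [trm]
  gcongr

lemma cmpr_add_le (ψ : ℝ≥0 → ℝ≥0) (x y : ℝ≥0) : cmpr ψ (x + y) ≤ cmpr ψ x + cmpr ψ y := by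
  unfold cmpr
  rw [← (trm_summable ψ x).tsum_add (trm_summable ψ y)]
  refine (trm_summable ψ _).tsum_le_tsum (fun n => ?_) ((trm_summable ψ x).add (trm_summable ψ y))
  simp only [trm, add_div]
  generalize x / brk ψ n = a
  generalize y / brk ψ n = b
  rcases le_total 1 a with h | h
  · rw [min_eq_left h]; exact (min_le_left _ _).trans (le_add_of_nonneg_right (zero_le))
  rcases le_total 1 b with h' | h'
  · rw [min_eq_left h']; exact (min_le_left _ _).trans (le_add_of_nonneg_left (zero_le))
  rw [min_eq_right h, min_eq_right h']; exact min_le_right _ _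

lemma exists_brk (ψ : ℝ≥0 → ℝ≥0) (y : ℝ≥0) : ∃ n, y < brk ψ n := by
  obtain ⟨n, hn⟩ := pow_unbounded_of_one_lt y (one_lt_two : (1 : ℝ≥0) < 2)
  exact ⟨n, hn.trans_le (le_mul_of_one_le_right (zero_le) (le_add_of_nonneg_right (zero_le)))⟩

lemma cmpr_strictMono (ψ : ℝ≥0 → ℝ≥0) : StrictMono (cmpr ψ) := by
  intro x y hxy
  obtain ⟨n, hn⟩ := exists_brk ψ y
  refine NNReal.tsum_lt_tsum (i := n) (fun k => trm_mono ψ k hxy.le) ?_ (trm_summable ψ y)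
  have hp := brk_pos ψ n
  have h1 : y / brk ψ n ≤ 1 := (div_le_one hp).2 hn.le
  have h2 : x / brk ψ n < y / brk ψ n := by gcongr
  simp only [trm]
  rw [min_eq_right h1, min_eq_right (h2.le.trans h1)]
  exact h2

lemma cmpr_dist (ψ : ℝ≥0 → ℝ≥0) (x y : ℝ≥0) : dist (cmpr ψ x) (cmpr ψ y) ≤ cmpr ψ (nndist x y) := by
  wlog hxy : x ≤ y generalizing x y
  · rw [dist_comm, nndist_comm]; exact this y x (le_of_not_ge hxy)
  obtain ⟨t, rfl⟩ := exists_add_of_le hxy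
  have hn : nndist x (x + t) = t := by
    apply NNReal.coe_injective
    rw [coe_nndist, NNReal.dist_eq]; simp
  rw [hn, NNReal.dist_eq, abs_sub_comm, abs_of_nonneg]
  · have := cmpr_add_le ψ x t
    have : (cmpr ψ (x + t) : ℝ) ≤ cmpr ψ x + cmpr ψ t := by exact_mod_cast this
    linarith
  · have : (cmpr ψ x : ℝ) ≤ cmpr ψ (x + t) := by exact_mod_cast (cmpr_strictMono ψ).monotone hxy
    linarith

lemma cmpr_cont (ψ : ℝ≥0 → ℝ≥0) : Continuous (cmpr ψ) := by
  refine (LipschitzWith.of_dist_le_mul (K := 2) fun x y => ?_).continuous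
  refine (cmpr_dist ψ x y).trans ?_
  have := cmpr_le ψ (nndist x y)
  rw [← coe_nndist, mul_comm]
  exact_mod_cast this

lemma cmpr_surj (ψ : ℝ≥0 → ℝ≥0) : Function.Surjective (cmpr ψ) := by
  intro y
  refine mem_range_of_exists_le_of_exists_ge (cmpr_cont ψ) ⟨0, ?_⟩ ?_
  · exact (cmpr_le ψ 0).trans (by simp)
  · obtain ⟨N, hN⟩ := exists_nat_ge y
    refine ⟨∑ k ∈ Finset.range N, brk ψ k, hN.trans ?_⟩
    refine le_trans ?_ ((trm_summable ψ _).sum_le_tsum (Finset.range N) (fun _ _ => zero_le))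
    rw [Finset.sum_congr rfl (g := fun _ => 1)]
    · simp
    · intro k hk
      refine min_eq_left ((one_le_div (brk_pos ψ k)).2 ?_)
      exact Finset.single_le_sum (f := brk ψ) (fun _ _ => zero_le) hk

lemma cmpr_growth (ψ : ℝ≥0 → ℝ≥0) (hψ : Monotone ψ) (R : ℝ≥0) (N : ℕ) (hN : R ≤ (N : ℝ≥0) ^ 2) :
    cmpr ψ (ψ R) ≤ N + 2 := by
  unfold cmpr
  rw [NNReal.sum_add_tsum_nat_add N (trm_summable ψ (ψ R)), ← tsum_geom]
  refine add_le_add ?_ ?_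
  · refine (Finset.sum_le_card_nsmul _ _ 1 (fun k _ => min_le_left _ _)).trans (by simp)
  · refine Summable.tsum_le_tsum (fun k => ?_) ((NNReal.summable_nat_add_iff N).2 (trm_summable ψ _)) sum_geom
    refine (min_le_right _ _).trans ?_
    rw [div_le_iff₀ (brk_pos ψ _), brk, ← mul_assoc, pow_add, ← mul_assoc, ← mul_pow, one_div,
      inv_mul_cancel₀ two_ne_zero, one_pow, one_mul]
    have h1 : ψ R ≤ ψ (((k + N : ℕ) : ℝ≥0) ^ 2) := by
      refine hψ (hN.trans ?_)
      gcongr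
      omega
    calc ψ R ≤ 1 + ψ (((k + N : ℕ) : ℝ≥0) ^ 2) := h1.trans (le_add_of_nonneg_left zero_le)
      _ ≤ _ := le_mul_of_one_le_left zero_le (one_le_pow₀ one_le_two)

lemma cmpr_anti (ψ : ℝ≥0 → ℝ≥0) : AntitoneOn (fun x : ℝ≥0 => cmpr ψ x / x) (Set.Ioi 0) := by
  intro x hx y hy hxy
  simp only [Set.mem_Ioi] at hx hy
  simp only
  rw [div_le_div_iff₀ hy hx]
  unfold cmpr
  rw [← NNReal.tsum_mul_right, ← NNReal.tsum_mul_right]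
  refine Summable.tsum_le_tsum (fun n => ?_) ((trm_summable ψ y).mul_right x)
    ((trm_summable ψ x).mul_right y)
  simp only [trm]
  rcases le_total 1 (x / brk ψ n) with h | h
  · rw [min_eq_left h]; exact mul_le_mul' (min_le_left _ _) hxy
  · rw [min_eq_right h]
    calc _ ≤ y / brk ψ n * x := mul_le_mul_left (min_le_right _ _) _
      _ = _ := by ring

/-- The half-line `[0,∞)` with its standard metric is compressible; moreover the
compressing homeomorphism can be chosen nondecreasing with `x ↦ h(x)/x` nonincreasing
on `(0,∞)`. -/
theorem halfLine_compressible :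
    ∀ ψ : ℝ≥0 → ℝ≥0, ProperFn ψ →
      ∃ (h : ℝ≥0 ≃ₜ ℝ≥0) (φ : ℝ≥0 → ℝ≥0), Sublinear φ ∧
        (∀ (R : ℝ≥0) (x y : ℝ≥0), dist x y < (ψ R : ℝ) → dist (h x) (h y) < (φ R : ℝ)) ∧
        Monotone (⇑h : ℝ≥0 → ℝ≥0) ∧
        AntitoneOn (fun x : ℝ≥0 => h x / x) (Set.Ioi 0) := by
  intro ψ hψ
  refine ⟨((cmpr_strictMono ψ).orderIsoOfSurjective _ (cmpr_surj ψ)).toHomeomorph,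
    fun R => cmpr ψ (ψ R), ?_, ?_, (cmpr_strictMono ψ).monotone, cmpr_anti ψ⟩
  · unfold Sublinear
    have hlim : Tendsto (fun t : ℝ≥0 => 4 / Real.sqrt (t : ℝ)) atTop (nhds 0) :=
      tendsto_const_nhds.div_atTop (Real.tendsto_sqrt_atTop.comp (NNReal.tendsto_coe_atTop.2 tendsto_id))
    refine squeeze_zero' (Eventually.of_forall fun t => by positivity) ?_ hlim
    filter_upwards [eventually_ge_atTop 1] with t ht
    have ht' : (1 : ℝ) ≤ t := by exact_mod_cast ht
    have hs : 1 ≤ Real.sqrt t := Real.one_le_sqrt.2 ht'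
    have hss : Real.sqrt t * Real.sqrt t = t := Real.mul_self_sqrt (by positivity)
    have h1 : Real.sqrt t ≤ ⌈Real.sqrt t⌉₊ := Nat.le_ceil _
    have h2 : (⌈Real.sqrt t⌉₊ : ℝ) < Real.sqrt t + 1 := Nat.ceil_lt_add_one (by positivity)
    have h3 := cmpr_growth ψ hψ.1 t ⌈Real.sqrt t⌉₊ (by
      rw [← NNReal.coe_le_coe]; push_cast; nlinarith)
    have h4 : (cmpr ψ (ψ t) : ℝ) ≤ ⌈Real.sqrt t⌉₊ + 2 := by exact_mod_cast h3
    rw [div_le_div_iff₀ (by linarith) (by linarith)]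
    nlinarith
  · intro R x y hxy
    refine (cmpr_dist ψ x y).trans_lt ?_
    rw [← coe_nndist] at hxy
    exact_mod_cast cmpr_strictMono ψ (by exact_mod_cast hxy)
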